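/- Let δ_1, …, δ_n be pairwise commuting locally nilpotent K-derivations of A, and for each i let (x_i^[j])_{0≤j<l_i} be an iterative δ_i-descent of maximal length l_i whose members all lie in ∩_{k≠i} A^{δ_k}. Set A^δ := ∩_i A^{δ_i}, E := {α ∈ ℕ^n : α_i < l_i}, x^[α] := x_1^[α_1]⋯x_n^[α_n], φ_i(a) := Σ_{0≤j<l_i} (-1)^j x_i^[j]·δ_i^j(a), ψ_i(a) := Σ_{0≤j<l_i} (-1)^j δ_i^j(a)·x_i^[j] (finite sums for each a), φ := φ_n∘⋯∘φ_1 and ψ := ψ_1∘⋯∘ψ_n. Then: φ is right A^δ-linear and ψ is left A^δ-linear; both are projections of A onto A^δ (im(φ)=im(ψ)=A^δ, φ(y)=ψ(y)=y for y ∈ A^δ); φ(x^[α]) = ψ(x^[α]) = 0 for all 0 ≠ α ∈ E; and every a ∈ A satisfies a = Σ_{α∈E} x^[α]·φ(δ^α(a)) = Σ_{α∈E} ψ(δ^α(a))·x^[α], where δ^α := δ_1^{α_1}∘⋯∘δ_n^{α_n}. -/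

import Mathlib

open LinearMap

/-- Operator form of an iterative `D`-descent of maximal length `l`: the operators `Y j` stand for
left or right multiplication by the `j`-th member, extended by zero beyond the range, and `P` is
the alternating sum attached to the descent. -/
structure IsOperatorDescent {K M : Type*} [Field K] [AddCommGroup M] [Module K M]
    (l : ℕ∞) (D : Module.End K M) (Y : ℕ → Module.End K M) (P : M → M) : Prop where
  locallyNilpotent : ∀ a, ∃ N, (D ^ N) a = 0
  pow_eq_zero : ∀ j : ℕ, l ≤ j → D ^ j = 0
  zero : Y 0 = 1
  step : ∀ j : ℕ, ((j + 1 : ℕ) : ℕ∞) < l → D * Y (j + 1) = Y j + Y (j + 1) * D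
  mul : ∀ j k : ℕ, ((j + k : ℕ) : ℕ∞) < l → Y j * Y k = (j + k).choose j • Y (j + k)
  apply_eq_sum : ∀ a N, (D ^ N) a = 0 →
    P a = ∑ j ∈ Finset.range N, ((-1 : ℤ) ^ j) • Y j ((D ^ j) a)

namespace IsOperatorDescent

variable {K M : Type*} [Field K] [AddCommGroup M] [Module K M]

theorem _root_.Module.End.pow_apply_eq_zero_of_le {D : Module.End K M} {a : M} {N N' : ℕ}
    (h : (D ^ N) a = 0) (hN : N ≤ N') : (D ^ N') a = 0 := by
  obtain ⟨k, rfl⟩ := Nat.exists_eq_add_of_le' hN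
  rw [pow_add, Module.End.mul_apply, h, map_zero]

section Single

variable {l : ℕ∞} {D : Module.End K M} {Y : ℕ → Module.End K M} {P : M → M}

theorem map_zero (h : IsOperatorDescent l D Y P) : P 0 = 0 := by
  simpa using h.apply_eq_sum 0 0 (by simp)

theorem map_add (h : IsOperatorDescent l D Y P) (a b : M) : P (a + b) = P a + P b := by
  obtain ⟨N, hN⟩ := h.locallyNilpotent a
  obtain ⟨N', hN'⟩ := h.locallyNilpotent b
  have ha := Module.End.pow_apply_eq_zero_of_le hN (le_max_left N N')
  have hb := Module.End.pow_apply_eq_zero_of_le hN' (le_max_right N N')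
  rw [h.apply_eq_sum a _ ha, h.apply_eq_sum b _ hb,
    h.apply_eq_sum (a + b) (max N N') (by simp [ha, hb]),
    ← Finset.sum_add_distrib]
  simp

theorem map_commute (h : IsOperatorDescent l D Y P) {T : Module.End K M} (hD : Commute T D)
    (hY : ∀ j, Commute T (Y j)) (a : M) : P (T a) = T (P a) := by
  obtain ⟨N, hN⟩ := h.locallyNilpotent a
  have hT : ∀ j, (D ^ j) (T a) = T ((D ^ j) a) := fun j =>
    (LinearMap.congr_fun (hD.pow_right j).eq a).symm
  rw [h.apply_eq_sum a N hN, h.apply_eq_sum (T a) N (by simp [hT, hN]), map_sum]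
  refine Finset.sum_congr rfl fun j _ => ?_
  rw [map_zsmul, hT]
  exact congrArg _ (LinearMap.congr_fun (hY j).eq _).symm

theorem map_of_mem_ker (h : IsOperatorDescent l D Y P) {y : M} (hy : D y = 0) : P y = y := by
  rw [h.apply_eq_sum y 1 (by simpa using hy)]
  simp [h.zero]

theorem step_apply_pow (h : IsOperatorDescent l D Y P) (j : ℕ) (a : M) :
    D (Y (j + 1) ((D ^ (j + 1)) a)) = Y j ((D ^ (j + 1)) a) + Y (j + 1) ((D ^ (j + 2)) a) := by
  rcases lt_or_ge ((j + 1 : ℕ) : ℕ∞) l with hj | hj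
  · rw [pow_succ' D (j + 1)]
    exact LinearMap.congr_fun (h.step j hj) _
  · rw [pow_succ' D (j + 1), h.pow_eq_zero _ hj]
    simp

theorem apply_map (h : IsOperatorDescent l D Y P) (a : M) : D (P a) = 0 := by
  have key : ∀ N, D (∑ j ∈ Finset.range (N + 1), ((-1 : ℤ) ^ j) • Y j ((D ^ j) a)) =
      ((-1 : ℤ) ^ N) • Y N ((D ^ (N + 1)) a) := by
    intro N
    induction N with
    | zero => simp [h.zero]
    | succ N ih =>
      rw [Finset.sum_range_succ, _root_.map_add, ih, map_zsmul, h.step_apply_pow, pow_succ]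
      module
  obtain ⟨N, hN⟩ := h.locallyNilpotent a
  have hN' := Module.End.pow_apply_eq_zero_of_le hN N.le_succ
  rw [h.apply_eq_sum a (N + 1) hN', key, hN', _root_.map_zero, smul_zero]

theorem mul_apply_pow (h : IsOperatorDescent l D Y P) (j k : ℕ) (a : M) :
    Y j (Y k ((D ^ (j + k)) a)) = (j + k).choose j • Y (j + k) ((D ^ (j + k)) a) := by
  rcases lt_or_ge ((j + k : ℕ) : ℕ∞) l with hj | hj
  · exact LinearMap.congr_fun (h.mul j k hj) _
  · rw [h.pow_eq_zero _ hj]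
    simp

theorem sum_apply_map_pow (h : IsOperatorDescent l D Y P) {a : M} {N : ℕ} (hN : (D ^ N) a = 0) :
    ∑ j ∈ Finset.range N, Y j (P ((D ^ j) a)) = a := by
  have hP : ∀ j ∈ Finset.range N, Y j (P ((D ^ j) a)) =
      ∑ k ∈ Finset.range (N - j), ((-1 : ℤ) ^ k) • Y j (Y k ((D ^ (j + k)) a)) := by
    intro j hj
    have hj' : j ≤ N := (Finset.mem_range.1 hj).le
    rw [h.apply_eq_sum ((D ^ j) a) (N - j) (by
      rw [← Module.End.mul_apply, ← pow_add, Nat.sub_add_cancel hj', hN]), map_sum]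
    refine Finset.sum_congr rfl fun k _ => ?_
    rw [map_zsmul, ← Module.End.mul_apply (D ^ k), ← pow_add, add_comm k j]
  rw [Finset.sum_congr rfl hP,
    ← Finset.sum_range_diag_flip N fun j k => ((-1 : ℤ) ^ k) • Y j (Y k ((D ^ (j + k)) a))]
  have hm : ∀ m ∈ Finset.range N, ∑ k ∈ Finset.range (m + 1),
      ((-1 : ℤ) ^ (m - k)) • Y k (Y (m - k) ((D ^ (k + (m - k))) a)) =
        if m = 0 then a else 0 := by
    intro m _
    have hk : ∀ k ∈ Finset.range (m + 1),
        ((-1 : ℤ) ^ (m - k)) • Y k (Y (m - k) ((D ^ (k + (m - k))) a)) =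
          ((-1 : ℤ) ^ k * (m.choose k : ℤ)) • (((-1 : ℤ) ^ m) • Y m ((D ^ m) a)) := by
      intro k hk
      have hkm : k ≤ m := Nat.lt_succ_iff.1 (Finset.mem_range.1 hk)
      rw [h.mul_apply_pow, Nat.add_sub_cancel' hkm, ← natCast_zsmul, smul_smul, smul_smul]
      congr 1
      obtain ⟨r, rfl⟩ := Nat.exists_eq_add_of_le hkm
      have hs : ((-1 : ℤ) ^ k) * (-1) ^ k = 1 := by rw [← mul_pow]; simp
      rw [Nat.add_sub_cancel_left, pow_add]
      linear_combination (-(-1 : ℤ) ^ r * ((k + r).choose k : ℤ)) * hs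
    rw [Finset.sum_congr rfl hk, ← Finset.sum_smul, Int.alternating_sum_range_choose]
    rcases eq_or_ne m 0 with rfl | hm0
    · simp [h.zero]
    · simp [hm0]
  rw [Finset.sum_congr rfl hm, Finset.sum_ite_eq' (Finset.range N) 0 fun _ => a]
  rcases N.eq_zero_or_pos with rfl | hpos
  · simpa using hN.symm
  · simp [hpos]

theorem pow_apply_member (h : IsOperatorDescent l D Y P) {b : M} (hb : D b = 0) :
    ∀ j k : ℕ, ((j + k : ℕ) : ℕ∞) < l → (D ^ k) (Y (j + k) b) = Y j b := by
  intro j k hjk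
  induction k with
  | zero => simp
  | succ k ih =>
    have := LinearMap.congr_fun (h.step (j + k) hjk) b
    simp only [Module.End.mul_apply, LinearMap.add_apply, hb, _root_.map_zero, add_zero] at this
    rw [pow_succ, Module.End.mul_apply, ← add_assoc, this]
    exact ih (lt_trans (by exact_mod_cast Nat.lt_succ_self _) hjk)

theorem map_member (h : IsOperatorDescent l D Y P) {b : M} (hb : D b = 0) (j : ℕ) (hj0 : j ≠ 0)
    (hj : (j : ℕ∞) < l) : P (Y j b) = 0 := by
  induction j using Nat.strong_induction_on with
  | _ j ih =>
    have hpow : ∀ k, k ≤ j → (D ^ k) (Y j b) = Y (j - k) b := fun k hk => by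
      simpa [Nat.sub_add_cancel hk] using
        h.pow_apply_member hb (j - k) k (by rwa [Nat.sub_add_cancel hk])
    have hj1 : (D ^ (j + 1)) (Y j b) = 0 := by
      rw [pow_succ', Module.End.mul_apply, hpow j le_rfl]
      simpa [h.zero] using hb
    have hsum := h.sum_apply_map_pow hj1
    obtain ⟨i, rfl⟩ := Nat.exists_eq_succ_of_ne_zero hj0
    rw [Finset.sum_range_succ, Finset.sum_range_succ', hpow _ le_rfl, Finset.sum_eq_zero] at hsum
    · simpa [h.zero, h.map_of_mem_ker hb] using hsum
    · intro k hk
      have hk' : k + 1 < i + 1 := by simpa using hk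
      rw [hpow _ hk'.le, ih _ (by omega) (by omega)
        (lt_of_le_of_lt (by exact_mod_cast Nat.sub_le _ _) hj), _root_.map_zero]

end Single

end IsOperatorDescent

section Family

variable {K M : Type*} [Field K] [AddCommGroup M] [Module K M] {n : ℕ}

/-- A family of operator descents for pairwise commuting `D i`, where the members of each descent
are killed by the other `D k`. -/
structure IsOperatorDescentFamily (l : Fin n → ℕ∞) (D : Fin n → Module.End K M)
    (Y : Fin n → ℕ → Module.End K M) (P : Fin n → M → M) : Prop where
  descent : ∀ i, IsOperatorDescent (l i) (D i) (Y i) (P i)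
  commute : ∀ i k, Commute (D i) (D k)
  commute_member : ∀ i k, k ≠ i → ∀ j, Commute (D k) (Y i j)

/-- The composite `P (n - 1) ∘ ⋯ ∘ P 0`. -/
def composeOfFn {M : Type*} {n : ℕ} (P : Fin n → M → M) (a : M) : M :=
  (List.ofFn P).foldl (fun b f => f b) a

theorem composeOfFn_succ {M : Type*} {n : ℕ} (P : Fin (n + 1) → M → M) (a : M) :
    composeOfFn P a = composeOfFn (fun i => P i.succ) (P 0 a) := by
  simp [composeOfFn, List.ofFn_succ]

theorem Commute.list_prod_ofFn_right {R : Type*} [Monoid R] {n : ℕ} {T : R} {f : Fin n → R}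
    (h : ∀ i, Commute T (f i)) : Commute T (List.ofFn f).prod :=
  Commute.list_prod_right _ _ fun y hy => by
    obtain ⟨i, rfl⟩ := List.mem_ofFn' _ _ |>.1 hy
    exact h i

theorem prod_ofFn_pow_apply_eq_zero {D : Fin n → Module.End K M}
    (hD : ∀ i k, Commute (D i) (D k)) {α : Fin n → ℕ} {a : M} {i : Fin n}
    (h : (D i ^ α i) a = 0) : (List.ofFn fun i => D i ^ α i).prod a = 0 := by
  induction n with
  | zero => exact i.elim0
  | succ n ih =>
    rw [List.ofFn_succ, List.prod_cons]
    induction i using Fin.cases with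
    | zero =>
      rw [(Commute.list_prod_ofFn_right fun k => (hD 0 k.succ).pow_pow _ _).eq,
        Module.End.mul_apply, h, map_zero]
    | succ i =>
      rw [Module.End.mul_apply, ih (D := fun i => D i.succ) (α := fun i => α i.succ)
        (fun i k => hD _ _) h, map_zero]

namespace IsOperatorDescentFamily

theorem tail {l : Fin (n + 1) → ℕ∞} {D : Fin (n + 1) → Module.End K M}
    {Y : Fin (n + 1) → ℕ → Module.End K M} {P : Fin (n + 1) → M → M}
    (h : IsOperatorDescentFamily l D Y P) :
    IsOperatorDescentFamily (fun i => l i.succ) (fun i => D i.succ) (fun i => Y i.succ)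
      (fun i => P i.succ) where
  descent i := h.descent i.succ
  commute i k := h.commute i.succ k.succ
  commute_member i k hk := h.commute_member i.succ k.succ ((Fin.succ_injective n).ne hk)

variable {l : Fin n → ℕ∞} {D : Fin n → Module.End K M}
    {Y : Fin n → ℕ → Module.End K M} {P : Fin n → M → M}

theorem map_zero (h : IsOperatorDescentFamily l D Y P) : composeOfFn P 0 = 0 := by
  induction n with
  | zero => rfl
  | succ n ih => rw [composeOfFn_succ, (h.descent 0).map_zero, ih h.tail]

theorem map_add (h : IsOperatorDescentFamily l D Y P) (a b : M) :
    composeOfFn P (a + b) = composeOfFn P a + composeOfFn P b := by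
  induction n generalizing a b with
  | zero => rfl
  | succ n ih => simp only [composeOfFn_succ, (h.descent 0).map_add, ih h.tail]

theorem map_commute (h : IsOperatorDescentFamily l D Y P) {T : Module.End K M}
    (hD : ∀ i, Commute T (D i)) (hY : ∀ i j, Commute T (Y i j)) (a : M) :
    composeOfFn P (T a) = T (composeOfFn P a) := by
  induction n generalizing a with
  | zero => rfl
  | succ n ih =>
    simp only [composeOfFn_succ, (h.descent 0).map_commute (hD 0) (hY 0)]
    exact ih h.tail (fun i => hD _) (fun i => hY _) _

theorem apply_map (h : IsOperatorDescentFamily l D Y P) (i : Fin n) (a : M) :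
    D i (composeOfFn P a) = 0 := by
  induction n generalizing a with
  | zero => exact i.elim0
  | succ n ih =>
    rw [composeOfFn_succ]
    induction i using Fin.cases with
    | zero =>
      rw [← h.tail.map_commute (fun i => h.commute 0 i.succ)
        (fun i => h.commute_member i.succ 0 (Fin.succ_ne_zero i).symm),
        (h.descent 0).apply_map, h.tail.map_zero]
    | succ i => exact ih h.tail i _

theorem map_of_mem_ker (h : IsOperatorDescentFamily l D Y P) {y : M} (hy : ∀ i, D i y = 0) :
    composeOfFn P y = y := by
  induction n with
  | zero => rfl
  | succ n ih =>
    rw [composeOfFn_succ, (h.descent 0).map_of_mem_ker (hy 0), ih h.tail fun i => hy _]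

theorem map_prod_member (h : IsOperatorDescentFamily l D Y P) {b : M} (hb : ∀ i, D i b = 0)
    {α : Fin n → ℕ} (hα : ∀ i, (α i : ℕ∞) < l i) (hα0 : α ≠ 0) :
    composeOfFn P ((List.ofFn fun i => Y i (α i)).prod b) = 0 := by
  induction n with
  | zero => exact absurd (Subsingleton.elim _ _) hα0
  | succ n ih =>
    rw [composeOfFn_succ, List.ofFn_succ, List.prod_cons, Module.End.mul_apply]
    have hker : D 0 ((List.ofFn fun i : Fin n => Y i.succ (α i.succ)).prod b) = 0 := by
      have := LinearMap.congr_fun (Commute.list_prod_ofFn_right fun i : Fin n =>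
        h.commute_member i.succ 0 (Fin.succ_ne_zero i).symm (α i.succ)).eq b
      simpa [hb 0] using this
    rcases eq_or_ne (α 0) 0 with h0 | h0
    · rw [h0, (h.descent 0).zero, Module.End.one_apply, (h.descent 0).map_of_mem_ker hker]
      refine ih h.tail (fun i => hb _) (fun i => hα _) fun hα' => hα0 ?_
      ext i
      induction i using Fin.cases with
      | zero => exact h0
      | succ i => exact congrFun hα' i
    · rw [(h.descent 0).map_member hker _ h0 (hα 0), h.tail.map_zero]

theorem sum_prod_apply_map (h : IsOperatorDescentFamily l D Y P) {a : M} {N : ℕ}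
    (hN : ∀ i, (D i ^ N) a = 0) :
    ∑ α ∈ Fintype.piFinset fun _ : Fin n => Finset.range N, (List.ofFn fun i => Y i (α i)).prod
      (composeOfFn P ((List.ofFn fun i => D i ^ α i).prod a)) = a := by
  induction n generalizing a with
  | zero => simp [composeOfFn]
  | succ n ih =>
    have hsplit : ∀ F : (Fin (n + 1) → ℕ) → M,
        ∑ α ∈ Fintype.piFinset fun _ : Fin (n + 1) => Finset.range N, F α =
          ∑ j ∈ Finset.range N, ∑ β ∈ Fintype.piFinset fun _ : Fin n => Finset.range N,
            F (Fin.cons j β) := fun F => by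
      rw [← Finset.sum_product']
      refine Finset.sum_nbij' (fun α => (α 0, Fin.tail α)) (fun p => Fin.cons p.1 p.2)
        ?_ ?_ ?_ ?_ ?_ <;> simp +contextual [Fin.forall_fin_succ, Fin.tail]
    rw [hsplit]
    conv_rhs => rw [← (h.descent 0).sum_apply_map_pow (hN 0)]
    refine Finset.sum_congr rfl fun j _ => ?_
    have hker : ∀ i : Fin n, (D i.succ ^ N) (P 0 ((D 0 ^ j) a)) = 0 := fun i => by
      rw [← (h.descent 0).map_commute ((h.commute _ _).pow_left _)
        (fun k => (h.commute_member 0 _ (Fin.succ_ne_zero i) k).pow_left _),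
        ← Module.End.mul_apply, ((h.commute _ _).pow_pow _ _).eq, Module.End.mul_apply, hN,
        _root_.map_zero, (h.descent 0).map_zero]
    conv_rhs => rw [← ih h.tail hker, map_sum]
    refine Finset.sum_congr rfl fun β _ => ?_
    simp only [List.ofFn_succ, List.prod_cons, Fin.cons_zero, Fin.cons_succ, Module.End.mul_apply,
      composeOfFn_succ]
    have hprod : Commute (List.ofFn fun i : Fin n => D i.succ ^ β i).prod (D 0) :=
      (Commute.list_prod_ofFn_right fun i => (h.commute 0 _).pow_right _).symm
    have hprodY : ∀ k, Commute (List.ofFn fun i : Fin n => D i.succ ^ β i).prod (Y 0 k) :=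
      fun k => (Commute.list_prod_ofFn_right fun i =>
        ((h.commute_member 0 _ (Fin.succ_ne_zero i) k).pow_left _).symm).symm
    have hswap := LinearMap.congr_fun (hprod.pow_right j).eq a
    rw [Module.End.mul_apply, Module.End.mul_apply] at hswap
    rw [← (h.descent 0).map_commute hprod hprodY, hswap]

theorem exists_pow_apply_eq_zero (h : IsOperatorDescentFamily l D Y P) (a : M) :
    ∃ N, ∀ i, (D i ^ N) a = 0 := by
  choose N hN using fun i => (h.descent i).locallyNilpotent a
  exact ⟨Finset.univ.sup N, fun i =>
    Module.End.pow_apply_eq_zero_of_le (hN i) (Finset.le_sup (Finset.mem_univ i))⟩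

end IsOperatorDescentFamily

end Family

theorem finsum_subtype_eq_sum {ι M : Type*} [AddCommMonoid M] {p : ι → Prop} {f g : ι → M}
    {s : Finset ι} (hfg : ∀ i ∈ s, p i → f i = g i) (hg : ∀ i ∈ s, ¬ p i → g i = 0)
    (hf : ∀ i ∉ s, p i → f i = 0) : ∑ᶠ i : {i // p i}, f i = ∑ i ∈ s, g i := by
  classical
  rw [finsum_subtype_eq_finsum_cond p, finsum_congr (g := fun i => if p i then f i else 0),
    finsum_eq_sum_of_support_subset (s := s)]
  · refine Finset.sum_congr rfl fun i hi => ?_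
    split_ifs with hp
    · exact hfg i hi hp
    · exact (hg i hi hp).symm
  · intro i hi
    by_contra his
    refine hi ?_
    dsimp only
    split_ifs with hp
    · exact hf i his hp
    · rfl
  · intro i
    split_ifs with hp <;> simp [hp]

theorem List.ofFn_comp_rev {β : Type*} {n : ℕ} (f : Fin n → β) :
    (List.ofFn fun i => f i.rev) = (List.ofFn f).reverse := by
  refine List.ext_getElem (by simp) fun i h₁ h₂ => ?_
  simp only [List.getElem_ofFn, List.getElem_reverse, List.length_ofFn]
  congr 1
  ext
  simp [Fin.val_rev]
  omega

section Descent

variable {K A : Type*} [Field K] [Ring A] [Algebra K A]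

theorem Module.End.commute_mulLeft_of_map_eq_zero {d : Module.End K A}
    (hd : ∀ a b : A, d (a * b) = d a * b + a * d b) {c : A} (hc : d c = 0) :
    Commute d (LinearMap.mulLeft K c) :=
  LinearMap.ext fun a => by simp [hd, hc]

theorem Module.End.commute_mulRight_of_map_eq_zero {d : Module.End K A}
    (hd : ∀ a b : A, d (a * b) = d a * b + a * d b) {c : A} (hc : d c = 0) :
    Commute d (LinearMap.mulRight K c) :=
  LinearMap.ext fun a => by simp [hd, hc]

theorem neg_one_pow_zsmul_eq_mul (j : ℕ) (a : A) : ((-1 : ℤ) ^ j) • a = (-1 : A) ^ j * a := by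
  simp [zsmul_eq_mul]

open Classical in
theorem isOperatorDescent_mulLeft {d : Module.End K A}
    (hd : ∀ a b : A, d (a * b) = d a * b + a * d b) (hln : ∀ a, ∃ m : ℕ, (d ^ m) a = 0)
    {l : ℕ∞} (hl : 1 ≤ l) (hpow : ∀ j : ℕ, l ≤ j → d ^ j = 0) {x : ℕ → A} (hx0 : x 0 = 1)
    (hxd : ∀ j : ℕ, ((j + 1 : ℕ) : ℕ∞) < l → d (x (j + 1)) = x j)
    (hiter : ∀ j k : ℕ, ((j + k : ℕ) : ℕ∞) < l → x j * x k = (j + k).choose j • x (j + k))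
    {φ : A → A} (hφ : ∀ a, φ a = ∑ᶠ j : {j : ℕ // (j : ℕ∞) < l},
      (-1 : A) ^ (j : ℕ) * (x (j : ℕ) * (d ^ (j : ℕ)) a)) :
    IsOperatorDescent l d (fun j => if (j : ℕ∞) < l then LinearMap.mulLeft K (x j) else 0) φ where
  locallyNilpotent := hln
  pow_eq_zero := hpow
  zero := by
    rw [if_pos (lt_of_lt_of_le (by simp) hl), hx0, LinearMap.mulLeft_one]
    rfl
  step j hj := by
    rw [if_pos hj, if_pos (lt_trans (by exact_mod_cast Nat.lt_succ_self j) hj)]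
    ext a
    simp [hd, hxd j hj]
  mul j k hjk := by
    rw [if_pos hjk, if_pos (lt_of_le_of_lt (by exact_mod_cast Nat.le_add_right j k) hjk),
      if_pos (lt_of_le_of_lt (by exact_mod_cast Nat.le_add_left k j) hjk)]
    ext a
    simp [← mul_assoc, hiter j k hjk]
  apply_eq_sum a N hN := by
    rw [hφ]
    refine finsum_subtype_eq_sum (p := fun j : ℕ => (j : ℕ∞) < l)
      (f := fun j => (-1 : A) ^ j * (x j * (d ^ j) a)) (fun j _ hj => ?_) (fun j _ hj => ?_)
      fun j hj _ => ?_
    · rw [if_pos hj, neg_one_pow_zsmul_eq_mul, LinearMap.mulLeft_apply]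
    · simp [hj]
    · simp [Module.End.pow_apply_eq_zero_of_le hN (by simpa using hj)]

open Classical in
theorem isOperatorDescent_mulRight {d : Module.End K A}
    (hd : ∀ a b : A, d (a * b) = d a * b + a * d b) (hln : ∀ a, ∃ m : ℕ, (d ^ m) a = 0)
    {l : ℕ∞} (hl : 1 ≤ l) (hpow : ∀ j : ℕ, l ≤ j → d ^ j = 0) {x : ℕ → A} (hx0 : x 0 = 1)
    (hxd : ∀ j : ℕ, ((j + 1 : ℕ) : ℕ∞) < l → d (x (j + 1)) = x j)
    (hiter : ∀ j k : ℕ, ((j + k : ℕ) : ℕ∞) < l → x j * x k = (j + k).choose j • x (j + k))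
    {ψ : A → A} (hψ : ∀ a, ψ a = ∑ᶠ j : {j : ℕ // (j : ℕ∞) < l},
      (-1 : A) ^ (j : ℕ) * ((d ^ (j : ℕ)) a * x (j : ℕ))) :
    IsOperatorDescent l d (fun j => if (j : ℕ∞) < l then LinearMap.mulRight K (x j) else 0) ψ where
  locallyNilpotent := hln
  pow_eq_zero := hpow
  zero := by
    rw [if_pos (lt_of_lt_of_le (by simp) hl), hx0, LinearMap.mulRight_one]
    rfl
  step j hj := by
    rw [if_pos hj, if_pos (lt_trans (by exact_mod_cast Nat.lt_succ_self j) hj)]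
    ext a
    simp [hd, hxd j hj, add_comm]
  mul j k hjk := by
    rw [if_pos hjk, if_pos (lt_of_le_of_lt (by exact_mod_cast Nat.le_add_right j k) hjk),
      if_pos (lt_of_le_of_lt (by exact_mod_cast Nat.le_add_left k j) hjk)]
    ext a
    have := hiter k j (by rwa [add_comm])
    rw [add_comm k j, ← Nat.choose_symm_add] at this
    simp [mul_assoc, this, -nsmul_eq_mul]
  apply_eq_sum a N hN := by
    rw [hψ]
    refine finsum_subtype_eq_sum (p := fun j : ℕ => (j : ℕ∞) < l)
      (f := fun j => (-1 : A) ^ j * ((d ^ j) a * x j)) (fun j _ hj => ?_) (fun j _ hj => ?_)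
      fun j hj _ => ?_
    · rw [if_pos hj, neg_one_pow_zsmul_eq_mul, LinearMap.mulRight_apply]
    · simp [hj]
    · simp [Module.End.pow_apply_eq_zero_of_le hN (by simpa using hj)]

theorem prod_map_mulLeft_apply (L : List A) (a : A) :
    (L.map (LinearMap.mulLeft K)).prod a = L.prod * a := by
  induction L with
  | nil => simp
  | cons c L ih => simp [ih, mul_assoc]

theorem prod_map_mulRight_apply (L : List A) (a : A) :
    (L.map (LinearMap.mulRight K)).prod a = a * L.reverse.prod := by
  induction L with
  | nil => simp
  | cons c L ih => simp [ih, mul_assoc]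

/-- Expansion of `a` as a sum over the whole exponent set of a family of operator descents. -/
theorem IsOperatorDescentFamily.eq_finsum {n : ℕ} {l : Fin n → ℕ∞} {D : Fin n → Module.End K A}
    {Y : Fin n → ℕ → Module.End K A} {P : Fin n → A → A} (h : IsOperatorDescentFamily l D Y P)
    (hY : ∀ i (j : ℕ), ¬ (j : ℕ∞) < l i → Y i j = 0) (a : A) :
    a = ∑ᶠ α : {α : Fin n → ℕ // ∀ i, (α i : ℕ∞) < l i},
      (List.ofFn fun i => Y i (α.1 i)).prod
        (composeOfFn P ((List.ofFn fun i => D i ^ α.1 i).prod a)) := by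
  obtain ⟨N, hN⟩ := h.exists_pow_apply_eq_zero a
  conv_lhs => rw [← h.sum_prod_apply_map hN]
  refine (finsum_subtype_eq_sum (p := fun α : Fin n → ℕ => ∀ i, (α i : ℕ∞) < l i)
    (f := fun α => (List.ofFn fun i => Y i (α i)).prod
      (composeOfFn P ((List.ofFn fun i => D i ^ α i).prod a)))
    (fun _ _ _ => rfl) (fun α _ hα => ?_) fun α hα _ => ?_).symm
  · obtain ⟨i, hi⟩ := not_forall.1 hα
    rw [List.prod_eq_zero ((List.mem_ofFn' _ _).2 ⟨i, hY i _ hi⟩), LinearMap.zero_apply]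
  · obtain ⟨i, hi⟩ : ∃ i, N ≤ α i := by simpa using hα
    rw [prod_ofFn_pow_apply_eq_zero h.commute
      (Module.End.pow_apply_eq_zero_of_le (hN i) hi), h.map_zero, _root_.map_zero]

end Descent

/-- With commuting locally nilpotent derivations `δ i` and iterative
`δ i`-descents `(x i j)_{j < l i}` of maximal length as in Statement 8, set
`φᵢ a := ∑_{j < l i} (-1)^j (x i j)·(δ i)^j a`, `ψᵢ a := ∑_{j < l i} (-1)^j ((δ i)^j a)·(x i j)`,
`Φ := φ_{n-1} ∘ ⋯ ∘ φ_0` and `Ψ := ψ_0 ∘ ⋯ ∘ ψ_{n-1}`.  Then `Φ` is right `A^δ`-linear and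
`Ψ` is left `A^δ`-linear, both are projections of `A` onto `A^δ := ∩ᵢ ker (δ i)`,
`Φ (x^[α]) = Ψ (x^[α]) = 0` for `0 ≠ α ∈ E`, and every `a ∈ A` satisfies
`a = ∑_{α ∈ E} x^[α]·Φ(δ^α a) = ∑_{α ∈ E} Ψ(δ^α a)·x^[α]` where
`δ^α := (δ 0)^{α 0} ∘ ⋯ ∘ (δ (n-1))^{α (n-1)}`. -/
theorem stmt_9 {K A : Type*} [Field K] [Ring A] [Algebra K A]
    (n : ℕ) (δ : Fin n → Module.End K A)
    (hleib : ∀ i, ∀ a b : A, δ i (a * b) = δ i a * b + a * δ i b)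
    (hcomm : ∀ i j, Commute (δ i) (δ j))
    (hln : ∀ i, ∀ a : A, ∃ m : ℕ, ((δ i) ^ m) a = 0)
    (l : Fin n → ℕ∞) (hl1 : ∀ i, 1 ≤ l i)
    (x : Fin n → ℕ → A)
    (hx0 : ∀ i, x i 0 = 1)
    (hxd : ∀ i (j : ℕ), ((j + 1 : ℕ) : ℕ∞) < l i → δ i (x i (j + 1)) = x i j)
    (hiter : ∀ i (j k : ℕ), ((j + k : ℕ) : ℕ∞) < l i →
      x i j * x i k = ((j + k).choose j) • x i (j + k))
    (hmax : ∀ i, (l i = ⊤ ∧ ∀ m : ℕ, (δ i) ^ m ≠ 0) ∨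
      (∃ m : ℕ, l i = (m : ℕ∞) ∧ (δ i) ^ m = 0))
    (hmem : ∀ i k, k ≠ i → ∀ j : ℕ, (j : ℕ∞) < l i → δ k (x i j) = 0)
    (φi ψi : Fin n → A → A)
    (hφi : ∀ i (a : A), φi i a =
      ∑ᶠ j : {j : ℕ // (j : ℕ∞) < l i},
        (-1 : A) ^ (j : ℕ) * (x i (j : ℕ) * ((δ i) ^ (j : ℕ)) a))
    (hψi : ∀ i (a : A), ψi i a =
      ∑ᶠ j : {j : ℕ // (j : ℕ∞) < l i},
        (-1 : A) ^ (j : ℕ) * (((δ i) ^ (j : ℕ)) a * x i (j : ℕ)))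
    (Φ Ψ : A → A)
    (hΦ : ∀ a : A, Φ a = (List.ofFn φi).foldl (fun b f => f b) a)
    (hΨ : ∀ a : A, Ψ a = (List.ofFn ψi).foldr (fun f b => f b) a) :
    (∀ a b : A, Φ (a + b) = Φ a + Φ b) ∧ (∀ a b : A, Ψ (a + b) = Ψ a + Ψ b) ∧
    (∀ a c : A, (∀ i, δ i c = 0) → Φ (a * c) = Φ a * c) ∧
    (∀ a c : A, (∀ i, δ i c = 0) → Ψ (c * a) = c * Ψ a) ∧
    (∀ a : A, ∀ i, δ i (Φ a) = 0) ∧ (∀ a : A, ∀ i, δ i (Ψ a) = 0) ∧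
    (∀ y : A, (∀ i, δ i y = 0) → Φ y = y ∧ Ψ y = y) ∧
    (∀ α : {α : Fin n → ℕ // ∀ i, ((α i : ℕ∞) < l i)}, α.1 ≠ 0 →
      Φ ((List.ofFn fun i => x i (α.1 i)).prod) = 0 ∧
      Ψ ((List.ofFn fun i => x i (α.1 i)).prod) = 0) ∧
    (∀ a : A, a = ∑ᶠ α : {α : Fin n → ℕ // ∀ i, ((α i : ℕ∞) < l i)},
      (List.ofFn fun i => x i (α.1 i)).prod *
        Φ (((List.ofFn fun i => (δ i) ^ (α.1 i)).prod) a)) ∧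
    (∀ a : A, a = ∑ᶠ α : {α : Fin n → ℕ // ∀ i, ((α i : ℕ∞) < l i)},
      Ψ (((List.ofFn fun i => (δ i) ^ (α.1 i)).prod) a) *
        (List.ofFn fun i => x i (α.1 i)).prod) := by
  classical
  have hpow : ∀ i, ∀ j : ℕ, l i ≤ j → δ i ^ j = 0 := fun i j hj => by
    rcases hmax i with ⟨h, -⟩ | ⟨m, h, hm⟩
    · simp [h] at hj
    · exact pow_eq_zero_of_le (by exact_mod_cast h ▸ hj) hm
  let Y : Fin n → ℕ → Module.End K A := fun i j =>
    if (j : ℕ∞) < l i then LinearMap.mulLeft K (x i j) else 0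
  let Z : Fin n → ℕ → Module.End K A := fun i j =>
    if (j : ℕ∞) < l i then LinearMap.mulRight K (x i j) else 0
  have hF : IsOperatorDescentFamily l δ Y φi :=
    { descent := fun i => isOperatorDescent_mulLeft (hleib i) (hln i) (hl1 i) (hpow i) (hx0 i)
        (hxd i) (hiter i) (hφi i)
      commute := hcomm
      commute_member := fun i k hk j => by
        dsimp only [Y]
        split_ifs with hj
        · exact Module.End.commute_mulLeft_of_map_eq_zero (hleib k) (hmem i k hk j hj)
        · exact Commute.zero_right _ }
  have hG : IsOperatorDescentFamily (fun i : Fin n => l i.rev) (fun i => δ i.rev)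
      (fun i => Z i.rev) (fun i => ψi i.rev) :=
    { descent := fun i => isOperatorDescent_mulRight (hleib _) (hln _) (hl1 _) (hpow _) (hx0 _)
        (hxd _) (hiter _) (hψi _)
      commute := fun i k => hcomm _ _
      commute_member := fun i k hk j => by
        dsimp only [Z]
        split_ifs with hj
        · exact Module.End.commute_mulRight_of_map_eq_zero (hleib _)
            (hmem _ _ (Fin.rev_injective.ne hk) j hj)
        · exact Commute.zero_right _ }
  obtain rfl : Φ = composeOfFn φi := funext hΦ
  obtain rfl : Ψ = composeOfFn fun i => ψi i.rev := funext fun a => by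
    rw [hΨ, composeOfFn, List.ofFn_comp_rev, List.foldl_reverse]
  have hprodY : ∀ α : Fin n → ℕ, (∀ i, (α i : ℕ∞) < l i) → ∀ b,
      (List.ofFn fun i => Y i (α i)).prod b = (List.ofFn fun i => x i (α i)).prod * b := by
    intro α hα b
    have hYα : (fun i => Y i (α i)) = LinearMap.mulLeft K ∘ fun i => x i (α i) :=
      funext fun i => if_pos (hα i)
    rw [hYα, ← List.map_ofFn, prod_map_mulLeft_apply]
  have hprodZ : ∀ α : Fin n → ℕ, (∀ i, (α i : ℕ∞) < l i) → ∀ b,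
      (List.ofFn fun i : Fin n => Z i.rev (α i.rev)).prod b =
        b * (List.ofFn fun i => x i (α i)).prod := by
    intro α hα b
    have hZα : (fun i : Fin n => Z i.rev (α i.rev)) =
        LinearMap.mulRight K ∘ fun i : Fin n => x i.rev (α i.rev) :=
      funext fun i => if_pos (hα i.rev)
    rw [hZα, ← List.map_ofFn, prod_map_mulRight_apply,
      List.ofFn_comp_rev fun i => x i (α i), List.reverse_reverse]
  have hone : ∀ i, δ i 1 = 0 := fun i => by simpa using hleib i 1 1
  refine ⟨hF.map_add, hG.map_add, fun a c hc => ?_, fun a c hc => ?_,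
    fun a i => hF.apply_map i a, fun a i => ?_,
    fun y hy => ⟨hF.map_of_mem_ker hy, hG.map_of_mem_ker fun i => hy _⟩,
    fun α hα => ⟨?_, ?_⟩, fun a => ?_, fun a => ?_⟩
  · refine hF.map_commute (T := LinearMap.mulRight K c)
      (fun i => (Module.End.commute_mulRight_of_map_eq_zero (hleib i) (hc i)).symm)
      (fun i j => ?_) a
    dsimp only [Y]
    split_ifs
    · exact (LinearMap.commute_mulLeft_right _ _).symm
    · exact Commute.zero_right _
  · refine hG.map_commute (T := LinearMap.mulLeft K c)
      (fun i => (Module.End.commute_mulLeft_of_map_eq_zero (hleib _) (hc _)).symm)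
      (fun i j => ?_) a
    dsimp only [Z]
    split_ifs
    · exact LinearMap.commute_mulLeft_right _ _
    · exact Commute.zero_right _
  · simpa using hG.apply_map i.rev a
  · simpa [hprodY α.1 α.2] using hF.map_prod_member hone α.2 hα
  · have hα' : (fun i : Fin n => α.1 i.rev) ≠ 0 := fun h0 => hα <| funext fun i => by
      simpa using congrFun h0 i.rev
    simpa [hprodZ α.1 α.2] using
      hG.map_prod_member (fun i => hone _) (fun i => α.2 i.rev) hα'
  · refine (hF.eq_finsum (fun i j hj => if_neg hj) a).trans (finsum_congr fun α => ?_)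
    exact hprodY α.1 α.2 _
  · let e : {α : Fin n → ℕ // ∀ i, (α i : ℕ∞) < l i} ≃
        {α : Fin n → ℕ // ∀ i, (α i : ℕ∞) < l i.rev} :=
      (Fin.revPerm.arrowCongr (Equiv.refl ℕ)).subtypeEquiv fun α =>
        Fin.revPerm.forall_congr_left.trans (by simp [Equiv.arrowCongr])
    refine (hG.eq_finsum (fun i j hj => if_neg hj) a).trans <|
      (finsum_comp_equiv e).symm.trans (finsum_congr fun α => ?_)
    have hδ : (List.ofFn fun i : Fin n => δ i.rev ^ α.1 i.rev).prod =
        (List.ofFn fun i => δ i ^ α.1 i).prod := by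
      rw [List.ofFn_comp_rev fun i => δ i ^ α.1 i]
      refine (List.reverse_perm _).prod_eq' (List.pairwise_of_forall_mem_list fun u hu v hv => ?_)
      rw [List.mem_reverse, List.mem_ofFn'] at hu hv
      obtain ⟨i, rfl⟩ := hu
      obtain ⟨k, rfl⟩ := hv
      exact (hcomm i k).pow_pow _ _
    rw [← hδ]
    exact hprodZ α.1 α.2 _
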